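/- arXiv:1912.00105 — 3 statements merged into one kernel-verified Lean document; each statement's English description precedes it below -/
import Mathlib

section
/- Let p1, p2 be real numbers and (r,s,t) a permutation of (1,2,3). The bilinear product on R^3 determined on the standard basis by e_r·e_r = e_r, e_r·e_s = e_s·e_r = 0, e_r·e_t = e_t·e_r = 0, e_s·e_s = e_s, e_s·e_t = e_t·e_s = e_t, and e_t·e_t = p1·e_s + p2·e_t is commutative and associative, and e_r + e_s is a two-sided unit for it; hence R^3 endowed with this product is an associative, commutative, unital real algebra (denoted A^3_{r,s}(p1,p2)). -/
noncomputable section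

/-- The `i`-th standard basis vector of `ℝ³`. -/
def e3 (i : Fin 3) : Fin 3 → ℝ := Pi.single i 1

/-- Every vector of `ℝ³` is a combination of `e_r`, `e_s`, `e_t` for distinct `r, s, t`. -/
theorem exists_eq_smul_e3_add {r s t : Fin 3} (hrs : r ≠ s) (hrt : r ≠ t) (hst : s ≠ t)
    (x : Fin 3 → ℝ) : ∃ a b c : ℝ, x = a • e3 r + b • e3 s + c • e3 t := by
  refine ⟨x r, x s, x t, ?_⟩
  ext i
  have hi : i = r ∨ i = s ∨ i = t := by omega
  rcases hi with rfl | rfl | rfl <;>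
    simp [e3, hrs, hrt, hst, hrs.symm, hrt.symm, hst.symm]

/-- For real numbers `p1, p2` and any permutation `(r,s,t)` of the indices, the bilinear
product on `ℝ³` determined on the standard basis by `e_r·e_r = e_r`,
`e_r·e_s = e_s·e_r = 0`, `e_r·e_t = e_t·e_r = 0`, `e_s·e_s = e_s`,
`e_s·e_t = e_t·e_s = e_t`, `e_t·e_t = p1·e_s + p2·e_t` is commutative and associative,
and `e_r + e_s` is a two-sided unit for it. -/
theorem stmt2 (p1 p2 : ℝ)
    (r s t : Fin 3) (hrs : r ≠ s) (hrt : r ≠ t) (hst : s ≠ t)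
    (mul : (Fin 3 → ℝ) → (Fin 3 → ℝ) → (Fin 3 → ℝ))
    (hlin_left : ∀ y, IsLinearMap ℝ (fun x => mul x y))
    (hlin_right : ∀ x, IsLinearMap ℝ (mul x))
    (hrr : mul (e3 r) (e3 r) = e3 r)
    (hrs' : mul (e3 r) (e3 s) = 0) (hsr : mul (e3 s) (e3 r) = 0)
    (hrt' : mul (e3 r) (e3 t) = 0) (htr : mul (e3 t) (e3 r) = 0)
    (hss : mul (e3 s) (e3 s) = e3 s)
    (hst' : mul (e3 s) (e3 t) = e3 t) (hts : mul (e3 t) (e3 s) = e3 t)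
    (htt : mul (e3 t) (e3 t) = p1 • e3 s + p2 • e3 t) :
    (∀ x y, mul x y = mul y x) ∧
    (∀ x y z, mul (mul x y) z = mul x (mul y z)) ∧
    (∀ x, mul (e3 r + e3 s) x = x ∧ mul x (e3 r + e3 s) = x) := by
  have add_mul' : ∀ x y z, mul (x + y) z = mul x z + mul y z :=
    fun x y z => (hlin_left z).map_add x y
  have smul_mul' : ∀ (c : ℝ) x z, mul (c • x) z = c • mul x z :=
    fun c x z => (hlin_left z).map_smul c x
  have mul_add' : ∀ x y z, mul x (y + z) = mul x y + mul x z :=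
    fun x => (hlin_right x).map_add
  have mul_smul' : ∀ (c : ℝ) x z, mul x (c • z) = c • mul x z :=
    fun c x => (hlin_right x).map_smul c
  have span := exists_eq_smul_e3_add hrs hrt hst
  refine ⟨fun x y => ?_, fun x y z => ?_, fun x => ?_⟩
  · obtain ⟨a, b, c, rfl⟩ := span x
    obtain ⟨a', b', c', rfl⟩ := span y
    simp only [add_mul', smul_mul', mul_add', mul_smul', hrr, hrs', hsr, hrt', htr, hss, hst',
      hts, htt]
    module
  · obtain ⟨a, b, c, rfl⟩ := span x
    obtain ⟨a', b', c', rfl⟩ := span y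
    obtain ⟨a'', b'', c'', rfl⟩ := span z
    simp only [add_mul', smul_mul', mul_add', mul_smul', hrr, hrs', hsr, hrt', htr, hss, hst',
      hts, htt, smul_zero, add_zero, zero_add]
    module
  · obtain ⟨a, b, c, rfl⟩ := span x
    simp only [add_mul', mul_add', mul_smul', smul_mul', hrr, hrs', hsr, hrt', htr, hss, hst',
      hts, smul_zero, add_zero, zero_add, add_assoc,
      and_self]
end
end

section
/- Let p1, p2 be real numbers, (r,s) a permutation of (1,2), A = A^2_r(p1,p2), Omega an open subset of R^2, and F = (f_1, f_2) : Omega -> R^2 Fréchet differentiable on Omega. Then the components of F satisfy the generalized Cauchy-Riemann equations ∂f_r/∂x_s = p1·∂f_s/∂x_r and ∂f_s/∂x_s = ∂f_r/∂x_r + p2·∂f_s/∂x_r at every point of Omega if and only if F is A-algebrizable on Omega. -/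
noncomputable section

/-- The `i`-th standard basis vector of `ℝ²`. -/
def e2 (i : Fin 2) : Fin 2 → ℝ := Pi.single i 1

/-- `A`-algebrizability (Lorch differentiability) of a vector field on an open set. -/
def IsAlgebrizable (mul : (Fin 2 → ℝ) → (Fin 2 → ℝ) → (Fin 2 → ℝ))
    (Ω : Set (Fin 2 → ℝ)) (F : (Fin 2 → ℝ) → (Fin 2 → ℝ)) : Prop :=
  ∃ F' : (Fin 2 → ℝ) → (Fin 2 → ℝ), ∀ w ∈ Ω,
    DifferentiableAt ℝ F w ∧ ∀ ξ, fderiv ℝ F w ξ = mul (F' w) ξ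

/-- Coordinates of a vector of `ℝ²` in the standard basis, listed in either order. -/
theorem eq_smul_e2_add_smul_e2 {r s : Fin 2} (hrs : r ≠ s) (v : Fin 2 → ℝ) :
    v = v r • e2 r + v s • e2 s := by
  ext i
  fin_cases r <;> fin_cases s <;> fin_cases i <;> simp_all [e2]

theorem e2_apply_self (i : Fin 2) : e2 i i = 1 := by simp [e2]

theorem e2_apply_of_ne {i j : Fin 2} (h : j ≠ i) : e2 i j = 0 := by simp [e2, h]

/-- Linear maps on `ℝ²` that agree on both standard basis vectors are equal. -/
theorem IsLinearMap.eq_of_eq_e2 {r s : Fin 2} (hrs : r ≠ s) {f g : (Fin 2 → ℝ) → (Fin 2 → ℝ)}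
    (hf : IsLinearMap ℝ f) (hg : IsLinearMap ℝ g) (hr : f (e2 r) = g (e2 r))
    (hs : f (e2 s) = g (e2 s)) (v : Fin 2 → ℝ) : f v = g v := by
  rw [eq_smul_e2_add_smul_e2 hrs v, hf.map_add, hg.map_add, hf.map_smul, hf.map_smul,
    hg.map_smul, hg.map_smul, hr, hs]

/-- Let `A = A²_r(p1,p2)` (product determined by `e_r·e_r = e_r`, `e_r·e_s = e_s·e_r = e_s`,
`e_s·e_s = p1·e_r + p2·e_s`), `Ω ⊆ ℝ²` open, and `F = (f₁,f₂)` Fréchet differentiable on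
`Ω`.  Then `F` satisfies the generalized Cauchy-Riemann equations
`∂f_r/∂x_s = p1·∂f_s/∂x_r` and `∂f_s/∂x_s = ∂f_r/∂x_r + p2·∂f_s/∂x_r` at every point of
`Ω` iff `F` is `A`-algebrizable on `Ω`. -/
theorem stmt5 (p1 p2 : ℝ) (r s : Fin 2) (hrs : r ≠ s)
    (mul : (Fin 2 → ℝ) → (Fin 2 → ℝ) → (Fin 2 → ℝ))
    (hlin_left : ∀ y, IsLinearMap ℝ (fun x => mul x y))
    (hlin_right : ∀ x, IsLinearMap ℝ (mul x))
    (hrr : mul (e2 r) (e2 r) = e2 r)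
    (hrs' : mul (e2 r) (e2 s) = e2 s)
    (hsr : mul (e2 s) (e2 r) = e2 s)
    (hss : mul (e2 s) (e2 s) = p1 • e2 r + p2 • e2 s)
    (Ω : Set (Fin 2 → ℝ)) (hΩ : IsOpen Ω)
    (F : (Fin 2 → ℝ) → (Fin 2 → ℝ))
    (hF : ∀ w ∈ Ω, DifferentiableAt ℝ F w) :
    (∀ w ∈ Ω,
        fderiv ℝ F w (e2 s) r = p1 * fderiv ℝ F w (e2 r) s ∧
        fderiv ℝ F w (e2 s) s = fderiv ℝ F w (e2 r) r + p2 * fderiv ℝ F w (e2 r) s)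
      ↔ IsAlgebrizable mul Ω F := by
  have mul_e2_r (v : Fin 2 → ℝ) : mul v (e2 r) = v :=
    IsLinearMap.eq_of_eq_e2 hrs (hlin_left (e2 r)) LinearMap.id.isLinear hrr hsr v
  have mul_e2_s (v : Fin 2 → ℝ) :
      mul v (e2 s) = v r • e2 s + v s • (p1 • e2 r + p2 • e2 s) := by
    have hl := hlin_left (e2 s)
    conv_lhs => rw [eq_smul_e2_add_smul_e2 hrs v]
    rw [hl.map_add, hl.map_smul, hl.map_smul, hrs', hss]
  constructor
  · intro h
    refine ⟨fun w => fderiv ℝ F w (e2 r), fun w hw => ⟨hF w hw, ?_⟩⟩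
    obtain ⟨h₁, h₂⟩ := h w hw
    refine IsLinearMap.eq_of_eq_e2 hrs (fderiv ℝ F w).toLinearMap.isLinear (hlin_right _)
      (mul_e2_r _).symm ?_
    rw [mul_e2_s, eq_smul_e2_add_smul_e2 hrs (fderiv ℝ F w (e2 s)), h₁, h₂]
    module
  · rintro ⟨F', h⟩ w hw
    have hL := (h w hw).2
    rw [hL, hL, mul_e2_r, mul_e2_s]
    simp only [Pi.add_apply, Pi.smul_apply, smul_eq_mul, e2_apply_self, e2_apply_of_ne hrs,
      e2_apply_of_ne hrs.symm]
    constructor <;> ring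
end
end

section
/- Let A = A^3_{r,s}(p1,p2) with (r,s,t) a permutation of (1,2,3), and let w = x_r·e_r + x_s·e_s + x_t·e_t. Set D = x_s^2 + p2·x_s·x_t - p1·x_t^2. Then w is invertible in A if and only if x_r·D ≠ 0, and in that case its inverse is w^{-1} = (1/x_r)·e_r + ((x_s + p2·x_t)/D)·e_s - (x_t/D)·e_t. -/
noncomputable section

/-- The product of two elements of `A³_{r,s}(p1,p2)` in the basis `e_r, e_s, e_t`. -/
theorem mul_eq_of_basis_products {V : Type*} [AddCommGroup V] [Module ℝ V] {p1 p2 : ℝ}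
    {er es et : V} {mul : V → V → V}
    (hlin_left : ∀ y, IsLinearMap ℝ (fun x => mul x y))
    (hlin_right : ∀ x, IsLinearMap ℝ (mul x))
    (hrr : mul er er = er) (hrs : mul er es = 0) (hsr : mul es er = 0)
    (hrt : mul er et = 0) (htr : mul et er = 0) (hss : mul es es = es)
    (hst : mul es et = et) (hts : mul et es = et)
    (htt : mul et et = p1 • es + p2 • et) (xr xs xt a b c : ℝ) :
    mul (xr • er + xs • es + xt • et) (a • er + b • es + c • et) =
      (xr * a) • er + (xs * b + p1 * xt * c) • es
        + (xt * b + (xs + p2 * xt) * c) • et := by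
  have add_left : ∀ x x' y, mul (x + x') y = mul x y + mul x' y :=
    fun x x' y => (hlin_left y).map_add x x'
  have smul_left : ∀ (k : ℝ) x y, mul (k • x) y = k • mul x y :=
    fun k x y => (hlin_left y).map_smul k x
  simp only [add_left, smul_left, (hlin_right _).map_add, (hlin_right _).map_smul,
    hrr, hrs, hsr, hrt, htr, hss, hst, hts, htt]
  module

/-- Coordinates with respect to `e_r, e_s, e_t` are unique. -/
theorem e3_combination_inj {r s t : Fin 3} (hrs : r ≠ s) (hrt : r ≠ t) (hst : s ≠ t)
    {a b c a' b' c' : ℝ}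
    (h : a • e3 r + b • e3 s + c • e3 t = a' • e3 r + b' • e3 s + c' • e3 t) :
    a = a' ∧ b = b' ∧ c = c' := by
  refine ⟨?_, ?_, ?_⟩
  · simpa [e3, Pi.single_apply, hrs, hrt] using congrFun h r
  · simpa [e3, Pi.single_apply, hrs.symm, hst] using congrFun h s
  · simpa [e3, Pi.single_apply, hrt.symm, hst.symm] using congrFun h t

/-- The vectors `e_r, e_s, e_t` span `ℝ³`. -/
theorem eq_e3_combination {r s t : Fin 3} (hrs : r ≠ s) (hrt : r ≠ t) (hst : s ≠ t)
    (v : Fin 3 → ℝ) : v = v r • e3 r + v s • e3 s + v t • e3 t := by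
  ext i
  have hi : i = r ∨ i = s ∨ i = t := by omega
  rcases hi with rfl | rfl | rfl
  · simp [e3, hrs, hrt]
  · simp [e3, hrs.symm, hst]
  · simp [e3, hrt.symm, hst.symm]

/-- Let `A = A³_{r,s}(p1,p2)` and `w = x_r·e_r + x_s·e_s + x_t·e_t`, and set
`D = x_s² + p2·x_s·x_t - p1·x_t²`.  Then `w` is invertible in `A` iff `x_r·D ≠ 0`,
and in that case its inverse is
`w⁻¹ = (1/x_r)·e_r + ((x_s + p2·x_t)/D)·e_s - (x_t/D)·e_t`. -/
theorem stmt13 (p1 p2 : ℝ)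
    (r s t : Fin 3) (hrs : r ≠ s) (hrt : r ≠ t) (hst : s ≠ t)
    (mul : (Fin 3 → ℝ) → (Fin 3 → ℝ) → (Fin 3 → ℝ))
    (hlin_left : ∀ y, IsLinearMap ℝ (fun x => mul x y))
    (hlin_right : ∀ x, IsLinearMap ℝ (mul x))
    (hrr : mul (e3 r) (e3 r) = e3 r)
    (hrs' : mul (e3 r) (e3 s) = 0) (hsr : mul (e3 s) (e3 r) = 0)
    (hrt' : mul (e3 r) (e3 t) = 0) (htr : mul (e3 t) (e3 r) = 0)
    (hss : mul (e3 s) (e3 s) = e3 s)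
    (hst' : mul (e3 s) (e3 t) = e3 t) (hts : mul (e3 t) (e3 s) = e3 t)
    (htt : mul (e3 t) (e3 t) = p1 • e3 s + p2 • e3 t)
    (xr xs xt : ℝ) (w : Fin 3 → ℝ)
    (hw : w = xr • e3 r + xs • e3 s + xt • e3 t)
    (D : ℝ) (hD : D = xs ^ 2 + p2 * xs * xt - p1 * xt ^ 2) :
    ((∃ v, mul w v = e3 r + e3 s) ↔ xr * D ≠ 0) ∧
    (xr * D ≠ 0 →
      mul w ((1 / xr) • e3 r + ((xs + p2 * xt) / D) • e3 s - (xt / D) • e3 t)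
        = e3 r + e3 s) := by
  have hmul := mul_eq_of_basis_products hlin_left hlin_right hrr hrs' hsr hrt' htr hss hst' hts htt
    xr xs xt
  have hinv : xr * D ≠ 0 →
      mul w ((1 / xr) • e3 r + ((xs + p2 * xt) / D) • e3 s - (xt / D) • e3 t)
        = e3 r + e3 s := by
    intro h
    have hxr : xr ≠ 0 := left_ne_zero_of_mul h
    have hD0 : D ≠ 0 := right_ne_zero_of_mul h
    have hr : xr * (1 / xr) = 1 := mul_one_div_cancel hxr
    have hs : xs * ((xs + p2 * xt) / D) + p1 * xt * -(xt / D) = 1 := by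
      field_simp
      rw [hD]
      ring
    have ht : xt * ((xs + p2 * xt) / D) + (xs + p2 * xt) * -(xt / D) = 0 := by
      ring
    rw [sub_eq_add_neg, ← neg_smul, hw, hmul, hr, hs, ht]
    module
  refine ⟨⟨?_, fun h => ⟨_, hinv h⟩⟩, hinv⟩
  rintro ⟨v, hv⟩
  have hunit : e3 r + e3 s = (1 : ℝ) • e3 r + (1 : ℝ) • e3 s + (0 : ℝ) • e3 t := by module
  rw [eq_e3_combination hrs hrt hst v, hw, hmul, hunit] at hv
  obtain ⟨h1, h2, h3⟩ := e3_combination_inj hrs hrt hst hv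
  refine mul_ne_zero (left_ne_zero_of_mul_eq_one h1) fun hD0 => ?_
  have hxt : xt = 0 := by
    linear_combination xs * h3 - xt * h2 - v t * hD0 + v t * hD
  have hxs : xs = 0 := by
    simpa [hD, hxt] using hD0
  simp [hxs, hxt] at h2
end
end
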